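/- If X is a finite simple graph in which every two distinct vertices are strongly cospectral and X has at least two vertices, then X is the complete graph K_2; that is, X has exactly two vertices and they are adjacent. -/

import Mathlib

open Matrix BigOperators

/-- A spectral decomposition of a real symmetric matrix `A`: the `θ r` are the distinct
eigenvalues and `E r` is the orthogonal projection onto the `θ r`-eigenspace. -/
structure IsSpectralDecomp {V : Type*} [Fintype V] [DecidableEq V] (A : Matrix V V ℝ)
    {m : ℕ} (θ : Fin m → ℝ) (E : Fin m → Matrix V V ℝ) : Prop where
  theta_inj : Function.Injective θ
  symm : ∀ r, (E r)ᵀ = E r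
  idem : ∀ r, E r * E r = E r
  mul_eq_zero : ∀ r s, r ≠ s → E r * E s = 0
  sum_eq_one : ∑ r, E r = 1
  eq_sum : A = ∑ r, θ r • E r
  ne_zero : ∀ r, E r ≠ 0

/-- A nonzero symmetric idempotent with entries constant up to sign along columns has all
diagonal entries equal to `1 / |V|`. -/
lemma card_mul_diag_eq_one {V : Type*} [Fintype V] {P : Matrix V V ℝ}
    (hsymm : Pᵀ = P) (hidem : P * P = P) (hne : P ≠ 0)
    (hsign : ∀ a b, P b a = P a a ∨ P b a = -P a a) (a : V) :
    (Fintype.card V : ℝ) * P a a = 1 := by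
  have hs : ∀ a b, P b a = P a b := fun a b => congrFun (congrFun hsymm a) b
  have hsq : ∀ a b, P b a * P b a = P a a * P a a := fun a b => by
    rcases hsign a b with h | h <;> simp [h]
  have hdiag : (Fintype.card V : ℝ) * (P a a * P a a) = P a a := by
    have h := congrFun (congrFun hidem a) a
    rw [Matrix.mul_apply, Finset.sum_congr rfl fun b _ =>
      show P a b * P b a = P a a * P a a by rw [← hs a b, hsq a b]] at h
    simpa using h
  have hpos : P a a ≠ 0 := by
    intro h0
    apply hne
    ext b c
    have hcc : P c c * P c c = 0 := by
      rw [← hsq c a, hs c a, hsq a c, h0, mul_zero]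
    have hbc := hsq c b
    rw [hcc] at hbc
    simpa using hbc
  apply mul_right_cancel₀ hpos
  linarith

/-- A sum over `s` of terms `±c` equals `(|s| - 2 j) c` for some `j ≤ |s|`. -/
lemma exists_sum_eq_card_sub {ι : Type*} (s : Finset ι) (f : ι → ℝ)
    (c : ℝ) (hf : ∀ i ∈ s, f i = c ∨ f i = -c) :
    ∃ j ≤ s.card, ∑ i ∈ s, f i = ((s.card : ℝ) - 2 * j) * c := by
  classical
  induction s using Finset.induction_on with
  | empty => exact ⟨0, by simp⟩
  | insert x s hx ih =>
    obtain ⟨j, hj, hsum⟩ := ih fun i hi => hf i (Finset.mem_insert_of_mem hi)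
    rw [Finset.card_insert_of_notMem hx, Finset.sum_insert hx, hsum]
    rcases hf x (Finset.mem_insert_self x s) with h | h
    · exact ⟨j, by omega, by rw [h]; push_cast; ring⟩
    · exact ⟨j + 1, by omega, by rw [h]; push_cast; ring⟩

namespace IsSpectralDecomp

variable {V : Type*} [Fintype V] [DecidableEq V] {A : Matrix V V ℝ} {m : ℕ} {θ : Fin m → ℝ}
  {E : Fin m → Matrix V V ℝ}

lemma mul_idempotent (h : IsSpectralDecomp A θ E) (r : Fin m) : A * E r = θ r • E r := by
  rw [h.eq_sum, Finset.sum_mul, Finset.sum_eq_single r]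
  · rw [smul_mul_assoc, h.idem]
  · intro s _ hsr
    rw [smul_mul_assoc, h.mul_eq_zero s r hsr, smul_zero]
  · simp

/-- If every idempotent has constant diagonal `1 / |V|`, then there are `|V|` eigenvalues. -/
lemma card_eq_of_diag (h : IsSpectralDecomp A θ E) [Nonempty V]
    (hdiag : ∀ r a, (Fintype.card V : ℝ) * E r a a = 1) : m = Fintype.card V := by
  obtain ⟨a⟩ := ‹Nonempty V›
  have hone : ∑ r, E r a a = 1 := by
    have := congrFun (congrFun h.sum_eq_one a) a
    simpa [Matrix.sum_apply] using this
  have hsum : ∑ r, (Fintype.card V : ℝ) * E r a a = m := by simp [hdiag]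
  rw [← Finset.mul_sum, hone, mul_one] at hsum
  exact_mod_cast hsum.symm

end IsSpectralDecomp

/-- If every two distinct vertices of `X` are strongly cospectral and `X` has at least
two vertices, then `X` is the complete graph `K₂`. -/
theorem eq_K2_of_all_stronglyCospectral {V : Type*} [Fintype V] [DecidableEq V]
    (X : SimpleGraph V) [DecidableRel X.Adj] {m : ℕ} (θ : Fin m → ℝ)
    (E : Fin m → Matrix V V ℝ) (hdec : IsSpectralDecomp (X.adjMatrix ℝ) θ E)
    (hcard : 2 ≤ Fintype.card V)
    (hsc : ∀ a b : V, a ≠ b →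
      ∀ r, E r *ᵥ Pi.single a 1 = E r *ᵥ Pi.single b 1 ∨
        E r *ᵥ Pi.single a 1 = -(E r *ᵥ Pi.single b 1)) :
    Fintype.card V = 2 ∧ ∀ a b : V, a ≠ b → X.Adj a b := by
  have hsign : ∀ r a b, E r b a = E r a a ∨ E r b a = -E r a a := by
    intro r a b
    rcases eq_or_ne a b with rfl | hab
    · exact Or.inl rfl
    have hs : E r b a = E r a b := congrFun (congrFun (hdec.symm r) a) b
    rw [hs]
    rcases hsc b a hab.symm r with h | h
    · exact Or.inl (by simpa using congrFun h a)
    · exact Or.inr (by simpa using congrFun h a)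
  have hdiag : ∀ r a, (Fintype.card V : ℝ) * E r a a = 1 := fun r a =>
    card_mul_diag_eq_one (hdec.symm r) (hdec.idem r) (hdec.ne_zero r) (hsign r) a
  have hdiag_ne : ∀ r a, E r a a ≠ 0 := fun r a => right_ne_zero_of_mul_eq_one (hdiag r a)
  have hnonempty : Nonempty V := Fintype.card_pos_iff.mp (by omega)
  have hm : m = Fintype.card V := hdec.card_eq_of_diag hdiag
  have heig : ∀ r a b, ∑ c ∈ X.neighborFinset b, E r c a = θ r * E r b a := by
    intro r a b
    have h := congrFun (congrFun (hdec.mul_idempotent r) b) a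
    rwa [SimpleGraph.adjMatrix_mul_apply] at h
  have hdeg : ∀ a, Fintype.card V ≤ X.degree a + 1 := by
    intro a
    have hθ : ∀ r, ∃ j ≤ X.degree a, θ r = (X.degree a : ℝ) - 2 * j := by
      intro r
      obtain ⟨j, hj, hsum⟩ := exists_sum_eq_card_sub (X.neighborFinset a) (fun c => E r c a)
        (E r a a) fun c _ => hsign r a c
      rw [heig, X.card_neighborFinset_eq_degree] at hsum
      exact ⟨j, by simpa using hj, mul_right_cancel₀ (hdiag_ne r a) hsum⟩
    choose j hj hθj using hθ
    have hinj : Function.Injective fun r => (⟨j r, Nat.lt_succ_of_le (hj r)⟩ :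
        Fin (X.degree a + 1)) := by
      intro r s hrs
      apply hdec.theta_inj
      rw [hθj r, hθj s, Fin.mk.inj hrs]
    simpa [hm] using Fintype.card_le_of_injective _ hinj
  have hnbr : ∀ a, X.neighborFinset a = Finset.univ.erase a := by
    intro a
    apply Finset.eq_of_subset_of_card_le
    · intro b hb
      simpa using (X.ne_of_adj ((X.mem_neighborFinset a b).mp hb)).symm
    · rw [Finset.card_erase_of_mem (Finset.mem_univ a), Finset.card_univ,
        X.card_neighborFinset_eq_degree]
      have := hdeg a
      omega
  refine ⟨le_antisymm ?_ hcard, fun a b hab => ?_⟩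
  · obtain ⟨a⟩ := hnonempty
    have hmem : ∀ r, θ r ∈ ({-1, (Fintype.card V : ℝ) - 1} : Finset ℝ) := by
      intro r
      have hrow : ∀ b, ∑ c, E r c a = (θ r + 1) * E r b a := by
        intro b
        have h := heig r a b
        rw [hnbr] at h
        rw [← Finset.sum_erase_add _ _ (Finset.mem_univ b), h]
        ring
      by_cases hneg : θ r = -1
      · simp [hneg]
      have hconst : ∀ b, E r b a = E r a a := fun b =>
        mul_left_cancel₀ (fun h0 => hneg (by linarith)) ((hrow b).symm.trans (hrow a))
      have h := hrow a
      simp only [hconst, Finset.sum_const, Finset.card_univ, nsmul_eq_mul] at h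
      have := mul_right_cancel₀ (hdiag_ne r a) h
      simp [this]
    have hle := Finset.card_le_card_of_injOn (s := Finset.univ) θ (fun r _ => hmem r)
      hdec.theta_inj.injOn
    rw [Finset.card_univ, Fintype.card_fin, hm] at hle
    exact hle.trans Finset.card_le_two
  · rw [← X.mem_neighborFinset, hnbr]
    simpa using hab.symm
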